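/- arXiv:1312.4468 — 3 statements merged into one kernel-verified Lean document; each statement's English description precedes it below -/
import Mathlib

section
/- Fix ρ > −1. The function x ↦ E0(ρ, BSC_x) on [0, 1/2] is strictly decreasing if ρ > 0, identically zero if ρ = 0, and strictly increasing if ρ ∈ (−1, 0). Moreover, for every ρ > −1 the function x ↦ R(ρ, BSC_x), where R(ρ, BSC_x) denotes the derivative of ρ ↦ E0(ρ, BSC_x) at ρ, is strictly decreasing in x on [0, 1/2]. -/
/-- A binary-input discrete memoryless channel: a nonempty finite output alphabet `Y`
together with conditional probability mass functions `W0 = W(·|0)` and `W1 = W(·|1)`. -/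
structure BDMC where
  Y : Type
  [fin : Fintype Y]
  [ne : Nonempty Y]
  W0 : Y → ℝ
  W1 : Y → ℝ
  W0_nonneg : ∀ y, 0 ≤ W0 y
  W1_nonneg : ∀ y, 0 ≤ W1 y
  sum_W0 : ∑ y, W0 y = 1
  sum_W1 : ∑ y, W1 y = 1

attribute [instance] BDMC.fin BDMC.ne

/-- Gallager's `E₀` function of a B-DMC under the uniform input distribution:
`E₀(ρ, W) = −log ∑_y (½ W(y|0)^{1/(1+ρ)} + ½ W(y|1)^{1/(1+ρ)})^{1+ρ}`. -/
noncomputable def E0 (ρ : ℝ) (W : BDMC) : ℝ :=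
  -Real.log (∑ y, ((1/2) * W.W0 y ^ (1/(1+ρ)) + (1/2) * W.W1 y ^ (1/(1+ρ))) ^ (1+ρ))

/-- `E₀` of the binary erasure channel with erasure probability `ε`:
`E₀(ρ, BEC_ε) = −log(2^{−ρ}(1−ε) + ε)`. -/
noncomputable def E0bec (ρ ε : ℝ) : ℝ := -Real.log ((2:ℝ) ^ (-ρ) * (1-ε) + ε)

/-- `E₀` of the binary symmetric channel with crossover probability `x`:
`E₀(ρ, BSC_x) = −log(2^{−ρ}(x^{1/(1+ρ)} + (1−x)^{1/(1+ρ)})^{1+ρ})`. -/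
noncomputable def E0bsc (ρ x : ℝ) : ℝ :=
  -Real.log ((2:ℝ) ^ (-ρ) * (x ^ (1/(1+ρ)) + (1-x) ^ (1/(1+ρ))) ^ (1+ρ))

/-- `R(ρ, W)`: the derivative of `ρ ↦ E₀(ρ, W)` at `ρ`. -/
noncomputable def RW (ρ : ℝ) (W : BDMC) : ℝ := deriv (fun r => E0 r W) ρ

/-- `R(ρ, BEC_ε)`: the derivative of `ρ ↦ E₀(ρ, BEC_ε)` at `ρ`. -/
noncomputable def Rbec (ρ ε : ℝ) : ℝ := deriv (fun r => E0bec r ε) ρ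

/-- `R(ρ, BSC_x)`: the derivative of `ρ ↦ E₀(ρ, BSC_x)` at `ρ`. -/
noncomputable def Rbsc (ρ x : ℝ) : ℝ := deriv (fun r => E0bsc r x) ρ

lemma StrictConcaveOn.map_add_map_one_sub_lt {f : ℝ → ℝ}
    (hf : StrictConcaveOn ℝ (Set.Ici 0) f) {x y : ℝ} (hx : 0 ≤ x) (hxy : x < y)
    (hy : y ≤ 1 / 2) : f x + f (1 - x) < f y + f (1 - y) := by
  have hd : 0 < 1 - 2 * x := by linarith
  set t := (y - x) / (1 - 2 * x) with ht
  have ht0 : 0 < t := div_pos (by linarith) hd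
  have ht1 : 0 < 1 - t := by
    rw [sub_pos, ht, div_lt_one hd]
    linarith
  have hty : t * (1 - 2 * x) = y - x := div_mul_cancel₀ _ hd.ne'
  have hx' : x ∈ Set.Ici (0 : ℝ) := hx
  have hx1 : 1 - x ∈ Set.Ici (0 : ℝ) := by
    rw [Set.mem_Ici]
    linarith
  have hne : x ≠ 1 - x := by linarith
  have h1 := hf.2 hx' hx1 hne ht1 ht0 (by ring)
  have h2 := hf.2 hx' hx1 hne ht0 ht1 (by ring)
  have e1 : (1 - t) • x + t • (1 - x) = y := by
    simp only [smul_eq_mul]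
    linarith
  have e2 : t • x + (1 - t) • (1 - x) = 1 - y := by
    simp only [smul_eq_mul]
    linarith
  rw [e1] at h1
  rw [e2] at h2
  simp only [smul_eq_mul] at h1 h2
  linarith

lemma rpow_add_one_sub_rpow_pos {x : ℝ} (hx : x ∈ Set.Icc (0 : ℝ) (1 / 2)) (s : ℝ) :
    0 < x ^ s + (1 - x) ^ s := by
  have h1 : 0 ≤ x ^ s := Real.rpow_nonneg hx.1 s
  have h2 : 0 < (1 - x) ^ s := Real.rpow_pos_of_pos (by linarith [hx.2]) s
  linarith

lemma E0bsc_eq {x : ℝ} (hx : x ∈ Set.Icc (0 : ℝ) (1 / 2)) (ρ : ℝ) :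
    E0bsc ρ x =
      ρ * Real.log 2 - (1 + ρ) * Real.log (x ^ (1 / (1 + ρ)) + (1 - x) ^ (1 / (1 + ρ))) := by
  have hZ := rpow_add_one_sub_rpow_pos hx (1 / (1 + ρ))
  rw [E0bsc, Real.log_mul (by positivity) (by positivity), Real.log_rpow two_pos,
    Real.log_rpow hZ]
  ring

lemma hasDerivAt_const_rpow_one_div_one_add {x ρ : ℝ} (hx : 0 ≤ x) (hρ : -1 < ρ) :
    HasDerivAt (fun r => x ^ (1 / (1 + r)))
      (-(1 / (1 + ρ)) ^ 2 * (x ^ (1 / (1 + ρ)) * Real.log x)) ρ := by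
  rcases hx.eq_or_lt with rfl | hx
  · simp only [Real.log_zero, mul_zero]
    refine (hasDerivAt_const ρ (0 : ℝ)).congr_of_eventuallyEq ?_
    filter_upwards [lt_mem_nhds hρ] with r hr
    exact Real.zero_rpow (one_div_ne_zero (by linarith))
  · have hs : HasDerivAt (fun r : ℝ => 1 / (1 + r)) (-(1 / (1 + ρ)) ^ 2) ρ := by
      have h := ((hasDerivAt_id ρ).const_add 1).fun_inv (by simp only [id]; linarith)
      simpa only [one_div, inv_pow, neg_div, id] using h
    convert hs.const_rpow hx using 1
    ring

/-- The rate at `ρ` is the entropy deficit of the tilted crossover probability. -/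
lemma Rbsc_eq_log_two_sub_binEntropy {x ρ : ℝ} (hx : x ∈ Set.Icc (0 : ℝ) (1 / 2))
    (hρ : -1 < ρ) :
    Rbsc ρ x = Real.log 2 - Real.binEntropy
      (x ^ (1 / (1 + ρ)) / (x ^ (1 / (1 + ρ)) + (1 - x) ^ (1 / (1 + ρ)))) := by
  have hr : 0 < 1 + ρ := by linarith
  have hx1 : 0 < 1 - x := by linarith [hx.2]
  have hZ := rpow_add_one_sub_rpow_pos hx (1 / (1 + ρ))
  have hA := hasDerivAt_const_rpow_one_div_one_add hx.1 hρ
  have hB := hasDerivAt_const_rpow_one_div_one_add hx1.le hρ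
  have hE := ((hasDerivAt_id ρ).mul_const (Real.log 2)).sub
    (((hasDerivAt_id ρ).const_add 1).mul ((hA.add hB).log hZ.ne'))
  have hfun : (fun r => E0bsc r x) = fun r =>
      r * Real.log 2 - (1 + r) * Real.log (x ^ (1 / (1 + r)) + (1 - x) ^ (1 / (1 + r))) :=
    funext (E0bsc_eq hx)
  rw [Rbsc, hfun]
  refine hE.deriv.trans ?_
  have hsr : (1 + ρ) * (1 / (1 + ρ)) = 1 := mul_one_div_cancel hr.ne'
  have hs : 0 < 1 / (1 + ρ) := one_div_pos.mpr hr
  have hlogA : x ^ (1 / (1 + ρ)) * Real.log (x ^ (1 / (1 + ρ))) =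
      x ^ (1 / (1 + ρ)) * (1 / (1 + ρ) * Real.log x) := by
    rcases hx.1.eq_or_lt with h | h
    · rw [← h, Real.zero_rpow hs.ne', zero_mul, zero_mul]
    · rw [Real.log_rpow h]
  have hlogB := Real.log_rpow hx1 (1 / (1 + ρ))
  have hBpos : 0 < (1 - x) ^ (1 / (1 + ρ)) := Real.rpow_pos_of_pos hx1 _
  simp only [Pi.add_apply, id]
  generalize 1 / (1 + ρ) = s at *
  generalize x ^ s = a at *
  generalize (1 - x) ^ s = b at *
  have hq : 1 - a / (a + b) = b / (a + b) := by
    field_simp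
    ring
  have hlogp : a / (a + b) * Real.log (a / (a + b)) =
      a * (s * Real.log x - Real.log (a + b)) / (a + b) := by
    rcases eq_or_ne a 0 with rfl | ha
    · simp
    · rw [Real.log_div ha hZ.ne', div_mul_eq_mul_div, mul_sub, mul_sub, hlogA]
  rw [Real.binEntropy, hq, Real.log_inv, Real.log_inv, mul_neg, mul_neg, hlogp,
    Real.log_div hBpos.ne' hZ.ne', hlogB]
  field_simp
  linear_combination (s * (a * Real.log x + b * Real.log (1 - x))) * hsr

lemma strictMonoOn_rpow_div_rpow_add_one_sub_rpow {s : ℝ} (hs : 0 < s) :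
    StrictMonoOn (fun x : ℝ => x ^ s / (x ^ s + (1 - x) ^ s)) (Set.Icc 0 (1 / 2)) := by
  intro x hx y hy hxy
  have ha : x ^ s < y ^ s := Real.rpow_lt_rpow hx.1 hxy hs
  have hb : (1 - y) ^ s < (1 - x) ^ s :=
    Real.rpow_lt_rpow (by linarith [hy.2]) (by linarith) hs
  have ha0 : 0 ≤ x ^ s := Real.rpow_nonneg hx.1 s
  have hb0 : 0 < (1 - y) ^ s := Real.rpow_pos_of_pos (by linarith [hy.2]) s
  change x ^ s / _ < y ^ s / _
  rw [div_lt_div_iff₀ (rpow_add_one_sub_rpow_pos hx s) (rpow_add_one_sub_rpow_pos hy s)]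
  nlinarith [mul_lt_mul'' ha hb ha0 hb0.le]

lemma rpow_div_rpow_add_one_sub_rpow_mem_Icc {s x : ℝ} (hs : 0 < s)
    (hx : x ∈ Set.Icc (0 : ℝ) (1 / 2)) :
    x ^ s / (x ^ s + (1 - x) ^ s) ∈ Set.Icc (0 : ℝ) 2⁻¹ := by
  have hZ := rpow_add_one_sub_rpow_pos hx s
  refine ⟨div_nonneg (Real.rpow_nonneg hx.1 s) hZ.le, ?_⟩
  have h : x ^ s ≤ (1 - x) ^ s := Real.rpow_le_rpow hx.1 (by linarith [hx.2]) hs.le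
  rw [div_le_iff₀ hZ]
  linarith

/-- Monotonicity of `x ↦ E₀(ρ, BSC_x)` on `[0,1/2]` (strictly decreasing for `ρ > 0`,
zero for `ρ = 0`, strictly increasing for `ρ ∈ (−1,0)`), and for every `ρ > −1` the
rate `x ↦ R(ρ, BSC_x)` is strictly decreasing on `[0,1/2]`. -/
theorem bsc_monotonicity (ρ : ℝ) (hρ : -1 < ρ) :
    ((0 < ρ → StrictAntiOn (fun x => E0bsc ρ x) (Set.Icc 0 (1/2))) ∧
     (ρ = 0 → ∀ x ∈ Set.Icc (0:ℝ) (1/2), E0bsc ρ x = 0) ∧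
     (ρ < 0 → StrictMonoOn (fun x => E0bsc ρ x) (Set.Icc 0 (1/2)))) ∧
    StrictAntiOn (fun x => Rbsc ρ x) (Set.Icc 0 (1/2)) := by
  have hr : 0 < 1 + ρ := by linarith
  have hs : 0 < 1 / (1 + ρ) := one_div_pos.mpr hr
  refine ⟨⟨fun h x hx y hy hxy => ?_, ?_, fun h x hx y hy hxy => ?_⟩,
    fun x hx y hy hxy => ?_⟩
  · have hs1 : 1 / (1 + ρ) < 1 := by
      rw [div_lt_one hr]
      linarith
    have hlt := (Real.strictConcaveOn_rpow hs hs1).map_add_map_one_sub_lt hx.1 hxy hy.2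
    have hlog := Real.log_lt_log (rpow_add_one_sub_rpow_pos hx _) hlt
    change E0bsc ρ y < E0bsc ρ x
    rw [E0bsc_eq hx, E0bsc_eq hy]
    linarith [mul_lt_mul_of_pos_left hlog hr]
  · rintro rfl x hx
    simp [E0bsc]
  · have hs1 : 1 < 1 / (1 + ρ) := by
      rw [lt_div_iff₀ hr]
      linarith
    have hlt := (strictConvexOn_rpow hs1).neg.map_add_map_one_sub_lt hx.1 hxy hy.2
    simp only [Pi.neg_apply] at hlt
    have hlog := Real.log_lt_log (rpow_add_one_sub_rpow_pos hy (1 / (1 + ρ)))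
      (by linarith : _ < x ^ (1 / (1 + ρ)) + (1 - x) ^ (1 / (1 + ρ)))
    change E0bsc ρ x < E0bsc ρ y
    rw [E0bsc_eq hx, E0bsc_eq hy]
    linarith [mul_lt_mul_of_pos_left hlog hr]
  · have h := Real.binEntropy_strictMonoOn (rpow_div_rpow_add_one_sub_rpow_mem_Icc hs hx)
      (rpow_div_rpow_add_one_sub_rpow_mem_Icc hs hy)
      (strictMonoOn_rpow_div_rpow_add_one_sub_rpow hs hx hy hxy)
    change Rbsc ρ y < Rbsc ρ x
    rw [Rbsc_eq_log_two_sub_binEntropy hx hρ, Rbsc_eq_log_two_sub_binEntropy hy hρ]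
    linarith
end

section
/- For every binary-input discrete memoryless channel W with finite output alphabet and every fixed ρ > −1, there exist an erasure probability ε ∈ [0, 1] and a crossover probability x ∈ [0, 1/2] such that E0(ρ, W) = E0(ρ, BEC_ε) = E0(ρ, BSC_x). -/
/-- The power function with exponent at least one is midpoint convex on the nonnegative reals. -/
lemma rpow_half_add_half_le {p u v : ℝ} (hp : 1 ≤ p) (hu : 0 ≤ u) (hv : 0 ≤ v) :
    ((1/2) * u + (1/2) * v) ^ p ≤ (1/2) * u ^ p + (1/2) * v ^ p :=
  (convexOn_rpow hp).2 hu hv (by norm_num) (by norm_num) (by norm_num)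

/-- For `ρ ≥ 0`, the power mean of exponent `1/(1+ρ)` of two nonnegative reals lies between
`2^{-ρ}` times their arithmetic mean and their arithmetic mean. -/
lemma powerMean_mem_Icc_of_nonneg {ρ a b : ℝ} (hρ : 0 ≤ ρ) (ha : 0 ≤ a) (hb : 0 ≤ b) :
    ((1/2) * a ^ (1/(1+ρ)) + (1/2) * b ^ (1/(1+ρ))) ^ (1+ρ) ∈
      Set.Icc ((2:ℝ) ^ (-ρ) * ((a + b) / 2)) ((a + b) / 2) := by
  have hp : 1 + ρ ≠ 0 := by positivity
  have cancel : ∀ c : ℝ, 0 ≤ c → (c ^ (1/(1+ρ))) ^ (1+ρ) = c := fun c hc => by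
    rw [← Real.rpow_mul hc, one_div_mul_cancel hp, Real.rpow_one]
  have hu := Real.rpow_nonneg ha (1/(1+ρ))
  have hv := Real.rpow_nonneg hb (1/(1+ρ))
  constructor
  · have h := Real.add_rpow_le_rpow_add hu hv (show 1 ≤ 1 + ρ by linarith)
    rw [cancel a ha, cancel b hb] at h
    rw [← mul_add, Real.mul_rpow (by norm_num) (by positivity), one_div (2:ℝ),
      Real.inv_rpow (by norm_num), ← Real.rpow_neg (by norm_num), neg_add, add_comm (-1 : ℝ),
      Real.rpow_add (by norm_num), Real.rpow_neg_one]
    have := mul_le_mul_of_nonneg_left h (show (0:ℝ) ≤ 2 ^ (-ρ) * 2⁻¹ by positivity)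
    linarith
  · have h := rpow_half_add_half_le (show 1 ≤ 1 + ρ by linarith) hu hv
    rw [cancel a ha, cancel b hb] at h
    linarith

/-- For `-1 < ρ ≤ 0`, the power mean of exponent `1/(1+ρ)` of two nonnegative reals lies between
their arithmetic mean and `2^{-ρ}` times their arithmetic mean. -/
lemma powerMean_mem_Icc_of_nonpos {ρ a b : ℝ} (hρ : -1 < ρ) (hρ0 : ρ ≤ 0)
    (ha : 0 ≤ a) (hb : 0 ≤ b) :
    ((1/2) * a ^ (1/(1+ρ)) + (1/2) * b ^ (1/(1+ρ))) ^ (1+ρ) ∈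
      Set.Icc ((a + b) / 2) ((2:ℝ) ^ (-ρ) * ((a + b) / 2)) := by
  have hp : 0 < 1 + ρ := by linarith
  have hs : 1 ≤ 1/(1+ρ) := by rw [le_div_iff₀ hp]; linarith
  have cancel : ∀ c : ℝ, 0 ≤ c → (c ^ (1/(1+ρ))) ^ (1+ρ) = c := fun c hc => by
    rw [← Real.rpow_mul hc, one_div_mul_cancel hp.ne', Real.rpow_one]
  have hu := Real.rpow_nonneg ha (1/(1+ρ))
  have hv := Real.rpow_nonneg hb (1/(1+ρ))
  constructor
  · have h := rpow_half_add_half_le hs ha hb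
    have h2 := Real.rpow_le_rpow (by positivity) h hp.le
    rw [cancel _ (by positivity)] at h2
    linarith
  · have h := Real.rpow_le_rpow (by positivity) (Real.add_rpow_le_rpow_add ha hb hs) hp.le
    rw [cancel _ (by positivity)] at h
    rw [← mul_add, Real.mul_rpow (by norm_num) (by positivity), one_div (2:ℝ),
      Real.inv_rpow (by norm_num), ← Real.rpow_neg (by norm_num), neg_add, add_comm (-1 : ℝ),
      Real.rpow_add (by norm_num), Real.rpow_neg_one]
    have := mul_le_mul_of_nonneg_left h (show (0:ℝ) ≤ 2 ^ (-ρ) * 2⁻¹ by positivity)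
    linarith

/-- The sum in Gallager's function lies between its values `2^{-ρ}` for a perfect channel
and `1` for a useless channel. -/
lemma gallager_sum_mem_uIcc (W : BDMC) {ρ : ℝ} (hρ : -1 < ρ) :
    ∑ y, ((1/2) * W.W0 y ^ (1/(1+ρ)) + (1/2) * W.W1 y ^ (1/(1+ρ))) ^ (1+ρ) ∈
      Set.uIcc ((2:ℝ) ^ (-ρ)) 1 := by
  have hsum : ∑ y, (W.W0 y + W.W1 y) / 2 = 1 := by
    rw [← Finset.sum_div, Finset.sum_add_distrib, W.sum_W0, W.sum_W1]; norm_num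
  have hsum2 : ∑ y, (2:ℝ) ^ (-ρ) * ((W.W0 y + W.W1 y) / 2) = 2 ^ (-ρ) := by
    rw [← Finset.mul_sum, hsum, mul_one]
  rcases le_total 0 ρ with h | h
  · have key y := powerMean_mem_Icc_of_nonneg h (W.W0_nonneg y) (W.W1_nonneg y)
    refine Set.Icc_subset_uIcc ⟨hsum2.symm.le.trans ?_, le_trans ?_ hsum.le⟩
    · exact Finset.sum_le_sum fun y _ => (key y).1
    · exact Finset.sum_le_sum fun y _ => (key y).2
  · have key y := powerMean_mem_Icc_of_nonpos hρ h (W.W0_nonneg y) (W.W1_nonneg y)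
    refine Set.Icc_subset_uIcc' ⟨hsum.symm.le.trans ?_, le_trans ?_ hsum2.le⟩
    · exact Finset.sum_le_sum fun y _ => (key y).1
    · exact Finset.sum_le_sum fun y _ => (key y).2

/-- For every B-DMC `W` and every `ρ > −1`, there are an erasure probability `ε ∈ [0,1]`
and a crossover probability `x ∈ [0,1/2]` with `E₀(ρ, W) = E₀(ρ, BEC_ε) = E₀(ρ, BSC_x)`. -/
theorem exists_bec_bsc_matching_E0 (W : BDMC) (ρ : ℝ) (hρ : -1 < ρ) :
    ∃ ε ∈ Set.Icc (0:ℝ) 1, ∃ x ∈ Set.Icc (0:ℝ) (1/2),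
      E0 ρ W = E0bec ρ ε ∧ E0 ρ W = E0bsc ρ x := by
  have hp : 0 < 1 + ρ := by linarith
  have hs : 0 < 1/(1+ρ) := by positivity
  have hS := gallager_sum_mem_uIcc W hρ
  obtain ⟨ε, hε, hεS⟩ : _ ∈ (fun ε : ℝ => (2:ℝ) ^ (-ρ) * (1-ε) + ε) '' Set.uIcc 0 1 :=
    intermediate_value_uIcc (by fun_prop) (by
      simpa only [sub_zero, mul_one, add_zero, sub_self, mul_zero, zero_add] using hS)
  have hcont : Continuous
      (fun x : ℝ => (2:ℝ) ^ (-ρ) * (x ^ (1/(1+ρ)) + (1-x) ^ (1/(1+ρ))) ^ (1+ρ)) :=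
    continuous_const.mul <| (((continuous_id.rpow_const fun _ => Or.inr hs.le).add
      ((continuous_const.sub continuous_id).rpow_const fun _ => Or.inr hs.le)).rpow_const
      fun _ => Or.inr hp.le)
  have h0 : (2:ℝ) ^ (-ρ) * ((0:ℝ) ^ (1/(1+ρ)) + (1-0) ^ (1/(1+ρ))) ^ (1+ρ) = 2 ^ (-ρ) := by
    rw [Real.zero_rpow hs.ne', sub_zero, zero_add, Real.one_rpow, Real.one_rpow, mul_one]
  have h1 : (2:ℝ) ^ (-ρ) * ((1/2:ℝ) ^ (1/(1+ρ)) + (1-1/2) ^ (1/(1+ρ))) ^ (1+ρ) = 1 := by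
    rw [sub_half, ← two_mul, Real.mul_rpow (by norm_num) (by positivity),
      ← Real.rpow_mul (by norm_num), one_div_mul_cancel hp.ne', Real.rpow_one, ← mul_assoc,
      ← Real.rpow_add (by norm_num), neg_add_cancel_comm_assoc, Real.rpow_one]
    norm_num
  obtain ⟨x, hx, hxS⟩ : _ ∈ (fun x : ℝ =>
      (2:ℝ) ^ (-ρ) * (x ^ (1/(1+ρ)) + (1-x) ^ (1/(1+ρ))) ^ (1+ρ)) '' Set.uIcc 0 (1/2) :=
    intermediate_value_uIcc hcont.continuousOn (by simpa only [h0, h1] using hS)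
  rw [Set.uIcc_of_le (by norm_num)] at hε hx
  exact ⟨ε, hε, x, hx, congrArg (fun t => -Real.log t) hεS.symm,
    congrArg (fun t => -Real.log t) hxS.symm⟩
end

section
/- (Theorem 1, Part 1.) Let W be a B-DMC with finite output alphabet, ε ∈ [0, 1], x ∈ [0, 1/2], and fix ρ₁ ∈ (0, 3]. If E0(ρ₁, BSC_x) ≤ E0(ρ₁, W) ≤ E0(ρ₁, BEC_ε), then for every ρ₂ ∈ [ρ₁, 3] one has both R(ρ₂, BSC_x) ≤ R(ρ₂, W) ≤ R(ρ₂, BEC_ε) and E0(ρ₂, BSC_x) ≤ E0(ρ₂, W) ≤ E0(ρ₂, BEC_ε). -/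
open Real

/-- Huygens' inequality for hyperbolic functions, multiplied by `cosh y`. -/
theorem three_mul_cosh_le {y : ℝ} (hy : 0 ≤ y) :
    3 * y * cosh y ≤ 2 * sinh y * cosh y + sinh y := by
  have hmono : MonotoneOn (fun t : ℝ => 2 * sinh t + sinh t / cosh t - 3 * t) (Set.Ici 0) := by
    have hd : ∀ t : ℝ, HasDerivAt (fun t : ℝ => 2 * sinh t + sinh t / cosh t - 3 * t)
        (2 * cosh t + (cosh t * cosh t - sinh t * sinh t) / cosh t ^ 2 - 3 * 1) t := fun t =>
      (((hasDerivAt_sinh t).const_mul 2).add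
        ((hasDerivAt_sinh t).div (hasDerivAt_cosh t) (cosh_pos t).ne')).sub
        ((hasDerivAt_id t).const_mul 3)
    refine monotoneOn_of_hasDerivWithinAt_nonneg (convex_Ici 0)
      (fun t _ => (hd t).continuousAt.continuousWithinAt)
      (fun t _ => (hd t).hasDerivWithinAt) fun t _ => ?_
    have h1 := cosh_pos t
    have h2 := cosh_sq t
    have h3 : cosh t * cosh t - sinh t * sinh t = 1 := by nlinarith
    rw [h3]
    have h4 : 2 * cosh t + 1 / cosh t ^ 2 - 3 * 1
        = (cosh t - 1) ^ 2 * (2 * cosh t + 1) / cosh t ^ 2 := by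
      field_simp; ring
    rw [h4]; positivity
  have h0 := hmono (Set.mem_Ici.2 le_rfl) (Set.mem_Ici.2 hy) hy
  have h1 := cosh_pos y
  simp only [sinh_zero, zero_div, mul_zero, add_zero, sub_zero] at h0
  have h2 : sinh y / cosh y * cosh y = sinh y := by field_simp
  nlinarith [mul_nonneg h0 h1.le]

theorem sinh_add_sinh_slope_nonpos {b c : ℝ} (hc : 0 ≤ c) (hb : b ∈ Set.Icc (0 : ℝ) (3 / 4)) :
    2 * b * c * cosh ((2 * b - 1) * c) - (sinh c + sinh ((2 * b - 1) * c)) ≤ 0 := by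
  set V : ℝ → ℝ := fun b => 2 * b * c * cosh ((2 * b - 1) * c) -
    (sinh c + sinh ((2 * b - 1) * c)) with hV
  have hd : ∀ t : ℝ, HasDerivAt V (4 * t * c ^ 2 * sinh ((2 * t - 1) * c)) t := fun t => by
    have h0 : HasDerivAt (fun b : ℝ => (2 * b - 1) * c) (2 * 1 * c) t :=
      (((hasDerivAt_id t).const_mul 2).sub_const 1).mul_const c
    have h1 : HasDerivAt (fun b : ℝ => 2 * b * c) (2 * 1 * c) t :=
      ((hasDerivAt_id t).const_mul 2).mul_const c
    refine ((h1.mul h0.cosh).sub (h0.sinh.const_add (sinh c))).congr_deriv ?_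
    ring
  have hcont : Continuous V := continuous_iff_continuousAt.2 fun t => (hd t).continuousAt
  rcases le_total b (1 / 2) with h | h
  · have hanti : AntitoneOn V (Set.Icc 0 (1 / 2)) := by
      refine antitoneOn_of_hasDerivWithinAt_nonpos (convex_Icc _ _) hcont.continuousOn
        (fun t _ => (hd t).hasDerivWithinAt) fun t ht => ?_
      rw [interior_Icc] at ht
      refine mul_nonpos_of_nonneg_of_nonpos (by have := ht.1; positivity) ?_
      rw [sinh_nonpos_iff]
      exact mul_nonpos_of_nonpos_of_nonneg (by linarith [ht.2]) hc
    have := hanti (Set.left_mem_Icc.2 (by norm_num)) ⟨hb.1, h⟩ hb.1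
    refine this.trans (le_of_eq ?_)
    simp [hV]
  · have hmono : MonotoneOn V (Set.Icc (1 / 2) (3 / 4)) := by
      refine monotoneOn_of_hasDerivWithinAt_nonneg (convex_Icc _ _) hcont.continuousOn
        (fun t _ => (hd t).hasDerivWithinAt) fun t ht => ?_
      rw [interior_Icc] at ht
      have h1 : 0 ≤ t := by linarith [ht.1]
      have h2 : 0 ≤ sinh ((2 * t - 1) * c) := by
        rw [sinh_nonneg_iff]
        exact mul_nonneg (by linarith [ht.1]) hc
      positivity
    have := hmono ⟨h, hb.2⟩ (Set.right_mem_Icc.2 (by norm_num)) hb.2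
    refine this.trans ?_
    have h3 := three_mul_cosh_le (y := c / 2) (by linarith)
    have h4 := sinh_two_mul (c / 2)
    rw [show 2 * (c / 2) = c by ring] at h4
    simp only [hV]
    rw [show (2 * (3 / 4) - 1) * c = c / 2 by ring]
    linarith

theorem antitoneOn_sinh_add_sinh_div {c : ℝ} (hc : 0 ≤ c) :
    AntitoneOn (fun b : ℝ => (sinh c + sinh ((2 * b - 1) * c)) / b) (Set.Ioc 0 (3 / 4)) := by
  have hd : ∀ t ∈ Set.Ioc (0 : ℝ) (3 / 4),
      HasDerivAt (fun b : ℝ => (sinh c + sinh ((2 * b - 1) * c)) / b)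
        ((2 * t * c * cosh ((2 * t - 1) * c) - (sinh c + sinh ((2 * t - 1) * c))) / t ^ 2) t := by
    intro t ht
    have h0 : HasDerivAt (fun b : ℝ => (2 * b - 1) * c) (2 * 1 * c) t :=
      (((hasDerivAt_id t).const_mul 2).sub_const 1).mul_const c
    refine ((h0.sinh.const_add (sinh c)).div (hasDerivAt_id t) ht.1.ne').congr_deriv ?_
    simp only [id]
    ring
  refine antitoneOn_of_hasDerivWithinAt_nonpos (convex_Ioc _ _)
    (fun t ht => (hd t ht).continuousAt.continuousWithinAt)
    (fun t ht => (hd t (interior_subset ht)).hasDerivWithinAt) fun t ht => ?_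
  have ht := interior_subset ht
  exact div_nonpos_of_nonpos_of_nonneg
    (sinh_add_sinh_slope_nonpos hc ⟨ht.1.le, ht.2⟩) (by positivity)

theorem rpow_curvature_le {p q a₁ a₂ : ℝ} (hq : 0 < q) (hqp : q ≤ p)
    (ha₂ : 1 / 4 ≤ a₂) (h12 : a₂ ≤ a₁) (ha₁ : a₁ < 1) :
    (1 - a₁) * (p - q + p * q ^ a₂ / p ^ a₂ - q * p ^ a₂ / q ^ a₂) ≤
      (1 - a₂) * (p - q + p * q ^ a₁ / p ^ a₁ - q * p ^ a₁ / q ^ a₁) := by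
  have hp : 0 < p := hq.trans_le hqp
  set c := (log p - log q) / 2 with hc
  have hc0 : 0 ≤ c := by
    have := log_le_log hq hqp
    rw [hc]; linarith
  have hp' : p = exp ((log p + log q) / 2) * exp c := by
    rw [← exp_add, hc]; ring_nf; rw [exp_log hp]
  have hq' : q = exp ((log p + log q) / 2) * exp (-c) := by
    rw [← exp_add, hc]; ring_nf; rw [exp_log hq]
  have key : ∀ a : ℝ, p - q + p * q ^ a / p ^ a - q * p ^ a / q ^ a =
      2 * exp ((log p + log q) / 2) * (sinh c + sinh ((2 * (1 - a) - 1) * c)) := by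
    intro a
    have h1 : p * q ^ a / p ^ a = exp ((log p + log q) / 2) * exp ((2 * (1 - a) - 1) * c) := by
      rw [rpow_def_of_pos hq, rpow_def_of_pos hp, ← exp_add]
      nth_rewrite 1 [← exp_log hp]
      rw [← exp_add, ← exp_sub, hc]
      ring_nf
    have h2 : q * p ^ a / q ^ a = exp ((log p + log q) / 2) * exp (-((2 * (1 - a) - 1) * c)) := by
      rw [rpow_def_of_pos hq, rpow_def_of_pos hp, ← exp_add]
      nth_rewrite 1 [← exp_log hq]
      rw [← exp_add, ← exp_sub, hc]
      ring_nf
    rw [h1, h2, sinh_eq, sinh_eq]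
    nth_rewrite 1 [hp']
    nth_rewrite 2 [hq']
    ring
  have h := antitoneOn_sinh_add_sinh_div hc0
    (show 1 - a₁ ∈ Set.Ioc (0 : ℝ) (3 / 4) from ⟨by linarith, by linarith⟩)
    (show 1 - a₂ ∈ Set.Ioc (0 : ℝ) (3 / 4) from ⟨by linarith, by linarith⟩) (by linarith)
  simp only at h
  rw [div_le_div_iff₀ (by linarith) (by linarith)] at h
  rw [key, key]
  nlinarith [mul_le_mul_of_nonneg_left h (exp_pos ((log p + log q) / 2)).le]

/-- The contribution `g(ρ, z)` of a binary symmetric channel with crossover probability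
`(1 - z) / 2` to the Gallager function: `exp (-E₀(ρ, W))` is an average of `g(ρ, ·)`. -/
noncomputable def gallagerKernel (ρ z : ℝ) : ℝ :=
  (1 / 2 * (1 + z) ^ (1 / (1 + ρ)) + 1 / 2 * (1 - z) ^ (1 / (1 + ρ))) ^ (1 + ρ)

/-- The absolute value of the `z`-derivative of `gallagerKernel`. -/
noncomputable def gallagerSlope (ρ z : ℝ) : ℝ :=
  (1 / 2 * (1 + z) ^ (1 / (1 + ρ)) + 1 / 2 * (1 - z) ^ (1 / (1 + ρ))) ^ ρ *
    ((1 - z) ^ (1 / (1 + ρ) - 1) - (1 + z) ^ (1 / (1 + ρ) - 1)) / 2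

theorem gallagerKernel_base_pos (a : ℝ) {z : ℝ} (hz : z ∈ Set.Icc (0 : ℝ) 1) :
    0 < 1 / 2 * (1 + z) ^ a + 1 / 2 * (1 - z) ^ a := by
  have h1 : 0 < (1 + z) ^ a := rpow_pos_of_pos (by linarith [hz.1]) _
  have h2 : 0 ≤ (1 - z) ^ a := rpow_nonneg (by linarith [hz.2]) _
  linarith

theorem gallagerKernel_pos (ρ : ℝ) {z : ℝ} (hz : z ∈ Set.Icc (0 : ℝ) 1) :
    0 < gallagerKernel ρ z :=
  rpow_pos_of_pos (gallagerKernel_base_pos _ hz) _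

theorem gallagerKernel_zero_right (ρ : ℝ) : gallagerKernel ρ 0 = 1 := by
  norm_num [gallagerKernel]

theorem gallagerKernel_one_right {ρ : ℝ} (hρ : -1 < ρ) : gallagerKernel ρ 1 = 2 ^ (-ρ) := by
  have h : 1 + ρ ≠ 0 := by linarith
  have h' : 1 / (1 + ρ) ≠ 0 := one_div_ne_zero h
  rw [gallagerKernel, sub_self, zero_rpow h', mul_zero, add_zero,
    mul_rpow (by norm_num) (by positivity), ← rpow_mul (by norm_num), one_div_mul_cancel h,
    rpow_one, one_div, inv_rpow (by norm_num), rpow_add (by norm_num), rpow_one,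
    rpow_neg (by norm_num)]
  norm_num
  field_simp

theorem gallagerKernel_zero_left (z : ℝ) : gallagerKernel 0 z = 1 := by
  simp [gallagerKernel]; ring

theorem gallagerKernel_antitone {r s z : ℝ} (hr : 0 ≤ r) (hrs : r ≤ s)
    (hz : z ∈ Set.Icc (0 : ℝ) 1) : gallagerKernel s z ≤ gallagerKernel r z := by
  have hr1 : 0 < 1 + r := by linarith
  have hs1 : 0 < 1 + s := by linarith
  have hp : 1 ≤ (1 + s) / (1 + r) := by rw [le_div_iff₀ hr1]; linarith
  have h1 : 0 ≤ 1 + z := by linarith [hz.1]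
  have h2 : 0 ≤ 1 - z := by linarith [hz.2]
  have hmean := (convexOn_rpow hp).2 (Set.mem_Ici.2 (rpow_nonneg h1 (1 / (1 + s))))
    (Set.mem_Ici.2 (rpow_nonneg h2 (1 / (1 + s)))) (show (0 : ℝ) ≤ 1 / 2 by norm_num)
    (show (0 : ℝ) ≤ 1 / 2 by norm_num) (by norm_num)
  simp only [smul_eq_mul] at hmean
  have he : 1 / (1 + s) * ((1 + s) / (1 + r)) = 1 / (1 + r) := by field_simp
  rw [← rpow_mul h1, ← rpow_mul h2, he] at hmean
  have hb := (gallagerKernel_base_pos (1 / (1 + s)) hz).le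
  have := rpow_le_rpow (rpow_nonneg hb _) hmean hr1.le
  rwa [← rpow_mul hb, div_mul_cancel₀ _ hr1.ne'] at this

theorem gallagerKernel_le_one {r z : ℝ} (hr : 0 ≤ r) (hz : z ∈ Set.Icc (0 : ℝ) 1) :
    gallagerKernel r z ≤ 1 :=
  (gallagerKernel_antitone le_rfl hr hz).trans_eq (gallagerKernel_zero_left z)

theorem two_rpow_neg_le_gallagerKernel {r z : ℝ} (hr : 0 ≤ r) (hz : z ∈ Set.Icc (0 : ℝ) 1) :
    2 ^ (-r) ≤ gallagerKernel r z := by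
  have hr1 : 0 < 1 + r := by linarith
  rw [← gallagerKernel_one_right (by linarith), gallagerKernel, gallagerKernel, sub_self,
    zero_rpow (one_div_ne_zero hr1.ne')]
  have h := rpow_add_le_add_rpow (p := 1 / (1 + r)) (show 0 ≤ 1 + z by linarith [hz.1])
    (show 0 ≤ 1 - z by linarith [hz.2]) (by positivity)
    (by rw [div_le_one hr1]; linarith)
  rw [show 1 + z + (1 - z) = 1 + 1 by ring] at h
  refine rpow_le_rpow (by positivity) ?_ hr1.le
  linarith

theorem continuousOn_gallagerKernel {r : ℝ} (hr : 0 ≤ r) :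
    ContinuousOn (gallagerKernel r) (Set.Icc 0 1) := by
  have h0 : 0 ≤ 1 / (1 + r) := by positivity
  refine ContinuousOn.rpow_const ?_ fun z hz => Or.inr (by linarith)
  refine ContinuousOn.add (ContinuousOn.mul continuousOn_const ?_)
    (ContinuousOn.mul continuousOn_const ?_)
  · exact ContinuousOn.rpow_const (by fun_prop) fun z hz => Or.inr h0
  · exact ContinuousOn.rpow_const (by fun_prop) fun z hz => Or.inr h0

theorem gallagerKernel_base_hasDerivAt (a : ℝ) {z : ℝ} (hz : z ∈ Set.Ioo (0 : ℝ) 1) :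
    HasDerivAt (fun z : ℝ => 1 / 2 * (1 + z) ^ a + 1 / 2 * (1 - z) ^ a)
      (a * ((1 + z) ^ (a - 1) - (1 - z) ^ (a - 1)) / 2) z := by
  have h1 : (1 : ℝ) + z ≠ 0 := by linarith [hz.1]
  have h2 : (1 : ℝ) - z ≠ 0 := by linarith [hz.2]
  refine (((((hasDerivAt_id z).const_add 1).rpow_const (p := a) (Or.inl h1)).const_mul
    (1 / 2)).add ((((hasDerivAt_id z).const_sub 1).rpow_const (p := a) (Or.inl h2)).const_mul
    (1 / 2))).congr_deriv ?_
  simp only [id]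
  ring

theorem hasDerivAt_gallagerKernel {r z : ℝ} (hr : 0 ≤ r) (hz : z ∈ Set.Ioo (0 : ℝ) 1) :
    HasDerivAt (gallagerKernel r) (-gallagerSlope r z) z := by
  have hr1 : 1 + r ≠ 0 := by linarith
  refine ((gallagerKernel_base_hasDerivAt (1 / (1 + r)) hz).rpow_const (p := 1 + r) (Or.inl
    (gallagerKernel_base_pos _ (Set.Ioo_subset_Icc_self hz)).ne')).congr_deriv ?_
  rw [gallagerSlope, add_sub_cancel_left]
  field_simp
  ring

theorem rpow_sub_rpow_pos {a z : ℝ} (ha : a < 0) (hz : z ∈ Set.Ioo (0 : ℝ) 1) :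
    0 < (1 - z) ^ a - (1 + z) ^ a :=
  sub_pos.2 (rpow_lt_rpow_of_neg (by linarith [hz.2]) (by linarith [hz.1]) ha)

theorem one_div_one_add_lt_one {r : ℝ} (hr : 0 < r) : 1 / (1 + r) - 1 < 0 := by
  rw [sub_neg, div_lt_one (by linarith)]; linarith

theorem gallagerSlope_pos {r z : ℝ} (hr : 0 < r) (hz : z ∈ Set.Ioo (0 : ℝ) 1) :
    0 < gallagerSlope r z := by
  have h1 := rpow_pos_of_pos (gallagerKernel_base_pos (1 / (1 + r))
    (Set.Ioo_subset_Icc_self hz)) r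
  have h2 := rpow_sub_rpow_pos (one_div_one_add_lt_one hr) hz
  rw [gallagerSlope]
  positivity

theorem curvature_denominator_pos {a z : ℝ} (ha : a < 1) (hz : z ∈ Set.Ioo (0 : ℝ) 1) :
    0 < (1 + z) - (1 - z) + (1 + z) * (1 - z) ^ a / (1 + z) ^ a -
      (1 - z) * (1 + z) ^ a / (1 - z) ^ a := by
  have hp : 0 < 1 + z := by linarith [hz.1]
  have hq : 0 < 1 - z := by linarith [hz.2]
  have hP := rpow_pos_of_pos hp a
  have hQ := rpow_pos_of_pos hq a
  have h := rpow_sub_rpow_pos (sub_neg.2 ha) hz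
  rw [rpow_sub_one hp.ne', rpow_sub_one hq.ne'] at h
  have e : (1 + z) - (1 - z) + (1 + z) * (1 - z) ^ a / (1 + z) ^ a -
      (1 - z) * (1 + z) ^ a / (1 - z) ^ a = ((1 - z) ^ a / (1 - z) - (1 + z) ^ a / (1 + z)) *
        ((1 + z) ^ a + (1 - z) ^ a) * ((1 + z) * (1 - z)) / ((1 + z) ^ a * (1 - z) ^ a) := by
    field_simp
    ring
  rw [e]
  positivity

theorem hasDerivAt_log_gallagerSlope {r z : ℝ} (hr : 0 < r) (hz : z ∈ Set.Ioo (0 : ℝ) 1) :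
    HasDerivAt (fun z => log (gallagerSlope r z))
      (4 / ((1 + z) * (1 - z)) * ((1 - 1 / (1 + r)) /
        ((1 + z) - (1 - z) + (1 + z) * (1 - z) ^ (1 / (1 + r)) / (1 + z) ^ (1 / (1 + r)) -
          (1 - z) * (1 + z) ^ (1 / (1 + r)) / (1 - z) ^ (1 / (1 + r))))) z := by
  set a := 1 / (1 + r) with ha
  have hra : r = (1 - a) / a := by rw [ha]; field_simp; ring
  have ha0 : 0 < a := by positivity
  have hp : 0 < 1 + z := by linarith [hz.1]
  have hq : 0 < 1 - z := by linarith [hz.2]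
  have hP := rpow_pos_of_pos hp a
  have hQ := rpow_pos_of_pos hq a
  have hM := gallagerKernel_base_pos a (Set.Ioo_subset_Icc_self hz)
  have hD := rpow_sub_rpow_pos (one_div_one_add_lt_one hr) hz
  rw [← ha] at hD
  have hlog : (fun z => r * log (1 / 2 * (1 + z) ^ a + 1 / 2 * (1 - z) ^ a) +
      log ((1 - z) ^ (a - 1) - (1 + z) ^ (a - 1)) - log 2) =ᶠ[nhds z]
      fun z => log (gallagerSlope r z) := by
    filter_upwards [isOpen_Ioo.mem_nhds hz] with w hw
    have hM := gallagerKernel_base_pos a (Set.Ioo_subset_Icc_self hw)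
    have hD := rpow_sub_rpow_pos (one_div_one_add_lt_one hr) hw
    rw [← ha] at hD
    rw [gallagerSlope, ← ha, log_div (mul_pos (rpow_pos_of_pos hM _) hD).ne' two_ne_zero,
      log_mul (rpow_pos_of_pos hM _).ne' hD.ne', log_rpow hM]
  have hdiff : HasDerivAt (fun z : ℝ => (1 - z) ^ (a - 1) - (1 + z) ^ (a - 1))
      ((1 - a) * ((1 - z) ^ (a - 1 - 1) + (1 + z) ^ (a - 1 - 1))) z := by
    refine ((((hasDerivAt_id z).const_sub 1).rpow_const (p := a - 1) (Or.inl hq.ne')).sub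
      (((hasDerivAt_id z).const_add 1).rpow_const (p := a - 1) (Or.inl hp.ne'))).congr_deriv ?_
    simp only [id]
    ring
  refine HasDerivAt.congr_of_eventuallyEq ?_ hlog.symm
  refine (((((gallagerKernel_base_hasDerivAt a hz).log hM.ne').const_mul r).add
    (hdiff.log hD.ne')).sub_const (log 2)).congr_deriv ?_
  rw [rpow_sub_one hq.ne', rpow_sub_one hp.ne'] at hD
  rw [rpow_sub_one hq.ne' (a - 1), rpow_sub_one hp.ne' (a - 1), rpow_sub_one hq.ne' a,
    rpow_sub_one hp.ne' a, hra]
  generalize (1 + z) ^ a = P at *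
  generalize (1 - z) ^ a = Q at *
  have hPQ : P + Q ≠ 0 := by positivity
  have e : (1 + z) - (1 - z) + (1 + z) * Q / P - (1 - z) * P / Q =
      (Q / (1 - z) - P / (1 + z)) * (P + Q) * ((1 + z) * (1 - z)) / (P * Q) := by
    field_simp
    ring
  rw [e]
  have hE : Q * (1 + z) - P * (1 - z) ≠ 0 := by
    have : Q / (1 - z) - P / (1 + z) = (Q * (1 + z) - P * (1 - z)) / ((1 + z) * (1 - z)) := by
      field_simp
    rw [this] at hD
    intro h
    simp [h] at hD
  have e2 : Q / (1 - z) - P / (1 + z) = (Q * (1 + z) - P * (1 - z)) / ((1 + z) * (1 - z)) := by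
    field_simp
  have e3 : P / (1 + z) - Q / (1 - z) = -((Q * (1 + z) - P * (1 - z)) / ((1 + z) * (1 - z))) := by
    rw [← e2]; ring
  have e4 : 1 / 2 * P + 1 / 2 * Q = (P + Q) / 2 := by ring
  rw [e2, e3, e4]
  have hp0 := hp.ne'
  have hq0 := hq.ne'
  field_simp
  ring

theorem monotoneOn_gallagerSlope_ratio {r s : ℝ} (hr : 0 < r) (hrs : r ≤ s) (hs : s ≤ 3) :
    MonotoneOn (fun z => gallagerSlope s z / gallagerSlope r z) (Set.Ioo 0 1) := by
  have hs0 := hr.trans_le hrs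
  have hlog : MonotoneOn (fun z => log (gallagerSlope s z) - log (gallagerSlope r z))
      (Set.Ioo 0 1) := by
    have hd := fun z (hz : z ∈ Set.Ioo (0 : ℝ) 1) =>
      (hasDerivAt_log_gallagerSlope hs0 hz).sub (hasDerivAt_log_gallagerSlope hr hz)
    refine monotoneOn_of_hasDerivWithinAt_nonneg (convex_Ioo _ _)
      (fun z hz => (hd z hz).continuousAt.continuousWithinAt)
      (fun z hz => (hd z (interior_subset hz)).hasDerivWithinAt) fun z hz => ?_
    have hz := interior_subset hz
    have hp : 0 < 1 + z := by linarith [hz.1]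
    have hq : 0 < 1 - z := by linarith [hz.2]
    have hr1 := sub_neg.1 (one_div_one_add_lt_one hr)
    have hs1 := sub_neg.1 (one_div_one_add_lt_one hs0)
    rw [← mul_sub]
    refine mul_nonneg (by positivity) (sub_nonneg.2 ?_)
    rw [div_le_div_iff₀ (curvature_denominator_pos hr1 hz) (curvature_denominator_pos hs1 hz)]
    exact rpow_curvature_le hq (by linarith [hz.1])
      (one_div_le_one_div_of_le (by linarith) (by linarith))
      (one_div_le_one_div_of_le (by linarith) (by linarith)) hr1
  intro z hz w hw hzw
  have h := hlog hz hw hzw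
  simp only at h ⊢
  have hsz := gallagerSlope_pos hs0 hz
  have hsw := gallagerSlope_pos hs0 hw
  have hrz := gallagerSlope_pos hr hz
  have hrw := gallagerSlope_pos hr hw
  rwa [← log_div hsz.ne' hrz.ne', ← log_div hsw.ne' hrw.ne',
    log_le_log_iff (by positivity) (by positivity)] at h

theorem gallagerKernel_sub_unimodal {r s z₀ : ℝ} (hr : 0 < r) (hrs : r ≤ s) (hs : s ≤ 3)
    (hz₀ : z₀ ∈ Set.Ioo (0 : ℝ) 1) :
    MonotoneOn (fun z => gallagerKernel s z -
      gallagerSlope s z₀ / gallagerSlope r z₀ * gallagerKernel r z) (Set.Icc 0 z₀) ∧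
    AntitoneOn (fun z => gallagerKernel s z -
      gallagerSlope s z₀ / gallagerSlope r z₀ * gallagerKernel r z) (Set.Icc z₀ 1) := by
  have hs0 := hr.trans_le hrs
  set κ := gallagerSlope s z₀ / gallagerSlope r z₀ with hκ
  have hcont : ContinuousOn (fun z => gallagerKernel s z - κ * gallagerKernel r z)
      (Set.Icc 0 1) :=
    (continuousOn_gallagerKernel hs0.le).sub
      (continuousOn_const.mul (continuousOn_gallagerKernel hr.le))
  have hd : ∀ z ∈ Set.Ioo (0 : ℝ) 1,
      HasDerivAt (fun z => gallagerKernel s z - κ * gallagerKernel r z)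
        (gallagerSlope r z * (κ - gallagerSlope s z / gallagerSlope r z)) z := fun z hz => by
    have := (gallagerSlope_pos hr hz).ne'
    refine ((hasDerivAt_gallagerKernel hs0.le hz).sub
      ((hasDerivAt_gallagerKernel hr.le hz).const_mul κ)).congr_deriv ?_
    field_simp
    ring
  have hratio := monotoneOn_gallagerSlope_ratio hr hrs hs
  constructor
  · refine monotoneOn_of_hasDerivWithinAt_nonneg (convex_Icc _ _)
      (hcont.mono (Set.Icc_subset_Icc_right hz₀.2.le))
      (f' := fun z => gallagerSlope r z * (κ - gallagerSlope s z / gallagerSlope r z))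
      (fun z hz => ?_) fun z hz => ?_ <;> rw [interior_Icc] at hz <;>
      have hz' : z ∈ Set.Ioo (0 : ℝ) 1 := ⟨hz.1, hz.2.trans hz₀.2⟩
    · exact (hd z hz').hasDerivWithinAt
    · exact mul_nonneg (gallagerSlope_pos hr hz').le (sub_nonneg.2 (hratio hz' hz₀ hz.2.le))
  · refine antitoneOn_of_hasDerivWithinAt_nonpos (convex_Icc _ _)
      (hcont.mono (Set.Icc_subset_Icc_left hz₀.1.le))
      (f' := fun z => gallagerSlope r z * (κ - gallagerSlope s z / gallagerSlope r z))
      (fun z hz => ?_) fun z hz => ?_ <;> rw [interior_Icc] at hz <;>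
      have hz' : z ∈ Set.Ioo (0 : ℝ) 1 := ⟨hz₀.1.trans hz.1, hz.2⟩
    · exact (hd z hz').hasDerivWithinAt
    · exact mul_nonpos_of_nonneg_of_nonpos (gallagerSlope_pos hr hz').le
        (sub_nonpos.2 (hratio hz₀ hz' hz.1.le))

theorem gallagerKernel_le_tangent {r s z₀ z : ℝ} (hr : 0 < r) (hrs : r ≤ s) (hs : s ≤ 3)
    (hz₀ : z₀ ∈ Set.Ioo (0 : ℝ) 1) (hz : z ∈ Set.Icc (0 : ℝ) 1) :
    gallagerKernel s z ≤ gallagerKernel s z₀ + gallagerSlope s z₀ / gallagerSlope r z₀ *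
      (gallagerKernel r z - gallagerKernel r z₀) := by
  obtain ⟨hmono, hanti⟩ := gallagerKernel_sub_unimodal hr hrs hs hz₀
  rcases le_total z z₀ with h | h
  · have := hmono ⟨hz.1, h⟩ (Set.right_mem_Icc.2 hz₀.1.le) h
    simp only at this
    linarith
  · have := hanti (Set.left_mem_Icc.2 hz₀.2.le) ⟨h, hz.2⟩ h
    simp only at this
    linarith

theorem gallagerKernel_chord_le {r s z : ℝ} (hr : 0 < r) (hrs : r ≤ s) (hs : s ≤ 3)
    (hz : z ∈ Set.Icc (0 : ℝ) 1) :
    (1 - 2 ^ (-s)) * (gallagerKernel r z - 2 ^ (-r)) ≤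
      (1 - 2 ^ (-r)) * (gallagerKernel s z - 2 ^ (-s)) := by
  have hs0 := hr.trans_le hrs
  have hlt : ∀ t : ℝ, 0 < t → 0 < 1 - (2 : ℝ) ^ (-t) := fun t ht =>
    sub_pos.2 (rpow_lt_one_of_one_lt_of_neg one_lt_two (neg_neg_of_pos ht))
  set D : ℝ → ℝ := fun z => (1 - 2 ^ (-r)) * (gallagerKernel s z - 2 ^ (-s)) -
    (1 - 2 ^ (-s)) * (gallagerKernel r z - 2 ^ (-r)) with hD
  have hD0 : D 0 = 0 := by simp only [hD, gallagerKernel_zero_right]; ring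
  have hD1 : D 1 = 0 := by
    simp only [hD, gallagerKernel_one_right (show -1 < r by linarith),
      gallagerKernel_one_right (show -1 < s by linarith)]
    ring
  obtain ⟨z₀, hz₀, hzero⟩ := exists_hasDerivAt_eq_zero (f := D)
    (f' := fun z => (1 - 2 ^ (-r)) * (-gallagerSlope s z) -
      (1 - 2 ^ (-s)) * (-gallagerSlope r z)) one_pos
    ((continuousOn_const.mul ((continuousOn_gallagerKernel hs0.le).sub continuousOn_const)).sub
      (continuousOn_const.mul ((continuousOn_gallagerKernel hr.le).sub continuousOn_const)))
    (hD0.trans hD1.symm) fun z hz =>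
      (((hasDerivAt_gallagerKernel hs0.le hz).sub_const _).const_mul _).sub
        (((hasDerivAt_gallagerKernel hr.le hz).sub_const _).const_mul _)
  have hκ : gallagerSlope s z₀ / gallagerSlope r z₀ * (1 - 2 ^ (-r)) = 1 - 2 ^ (-s) := by
    have := gallagerSlope_pos hr hz₀
    field_simp
    linarith
  obtain ⟨hmono, hanti⟩ := gallagerKernel_sub_unimodal hr hrs hs hz₀
  have hDeq : ∀ w, D w = (1 - 2 ^ (-r)) * (gallagerKernel s w -
      gallagerSlope s z₀ / gallagerSlope r z₀ * gallagerKernel r w) -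
      ((1 - 2 ^ (-r)) * 2 ^ (-s) - (1 - 2 ^ (-s)) * 2 ^ (-r)) := fun w => by
    simp only [hD]
    linear_combination gallagerKernel r w * hκ
  suffices 0 ≤ D z by simp only [hD] at this; linarith
  rcases le_total z z₀ with h | h
  · have := hmono (Set.left_mem_Icc.2 hz₀.1.le) ⟨hz.1, h⟩ hz.1
    have := mul_le_mul_of_nonneg_left this (hlt r hr).le
    simp only at this
    linarith [hDeq z, hDeq 0]
  · have := hanti ⟨h, hz.2⟩ (Set.right_mem_Icc.2 hz₀.2.le) hz.2
    have := mul_le_mul_of_nonneg_left this (hlt r hr).le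
    simp only at this
    linarith [hDeq z, hDeq 1]

theorem differentiableAt_gallagerKernel_left {r z : ℝ} (hr : 0 < r)
    (hz : z ∈ Set.Icc (0 : ℝ) 1) : DifferentiableAt ℝ (fun t => gallagerKernel t z) r := by
  have hr1 : 1 + r ≠ 0 := by linarith
  have hexp : DifferentiableAt ℝ (fun t : ℝ => 1 / (1 + t)) r :=
    (differentiableAt_const 1).div (differentiableAt_id.const_add 1) hr1
  have hp : 0 < 1 + z := by linarith [hz.1]
  have h2 : DifferentiableAt ℝ (fun t : ℝ => (1 - z) ^ (1 / (1 + t))) r := by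
    rcases hz.2.lt_or_eq with h | h
    · exact (differentiableAt_const _).rpow hexp (sub_pos.2 h).ne'
    · refine (differentiableAt_const (0 : ℝ)).congr_of_eventuallyEq ?_
      filter_upwards [lt_mem_nhds hr] with t ht
      rw [h, sub_self, zero_rpow (one_div_ne_zero (by linarith))]
  exact DifferentiableAt.rpow ((((differentiableAt_const _).rpow hexp hp.ne').const_mul _).add
    (h2.const_mul _)) (differentiableAt_id.const_add 1) (gallagerKernel_base_pos _ hz).ne'

theorem deriv_le_deriv_of_le_left {f g : ℝ → ℝ} {a s : ℝ} (has : a < s)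
    (hf : DifferentiableAt ℝ f s) (hg : DifferentiableAt ℝ g s) (heq : f s = g s)
    (hle : ∀ r ∈ Set.Ioo a s, g r ≤ f r) : deriv f s ≤ deriv g s := by
  have h := (hf.hasDerivAt.sub hg.hasDerivAt).hasDerivWithinAt (s := Set.Iio s)
  rw [hasDerivWithinAt_iff_tendsto_slope' (show s ∉ Set.Iio s from lt_irrefl s)] at h
  refine sub_nonpos.1 (le_of_tendsto h ?_)
  filter_upwards [Ioo_mem_nhdsLT has] with r hr
  rw [slope_def_field]
  refine div_nonpos_of_nonneg_of_nonpos ?_ (by linarith [hr.2])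
  simp only [Pi.sub_apply]
  linarith [hle r hr]

section Mean

variable {Y : Type*} [Fintype Y] {q z : Y → ℝ}

/-- The average of `gallagerKernel ρ` over a finitely supported measure. -/
noncomputable def gallagerMean (q z : Y → ℝ) (ρ : ℝ) : ℝ := ∑ y, q y * gallagerKernel ρ (z y)

theorem differentiableAt_gallagerMean (hz : ∀ y, z y ∈ Set.Icc (0 : ℝ) 1) {r : ℝ} (hr : 0 < r) :
    DifferentiableAt ℝ (gallagerMean q z) r :=
  DifferentiableAt.fun_sum fun y _ =>
    (differentiableAt_gallagerKernel_left hr (hz y)).const_mul (q y)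

theorem gallagerMean_antitone (hq : ∀ y, 0 ≤ q y) (hz : ∀ y, z y ∈ Set.Icc (0 : ℝ) 1) {r s : ℝ}
    (hr : 0 ≤ r) (hrs : r ≤ s) : gallagerMean q z s ≤ gallagerMean q z r :=
  Finset.sum_le_sum fun y _ =>
    mul_le_mul_of_nonneg_left (gallagerKernel_antitone hr hrs (hz y)) (hq y)

theorem gallagerMean_le_one (hq : ∀ y, 0 ≤ q y) (hq1 : ∑ y, q y = 1)
    (hz : ∀ y, z y ∈ Set.Icc (0 : ℝ) 1) {r : ℝ} (hr : 0 ≤ r) : gallagerMean q z r ≤ 1 := by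
  rw [← hq1]
  exact Finset.sum_le_sum fun y _ =>
    mul_le_of_le_one_right (hq y) (gallagerKernel_le_one hr (hz y))

theorem two_rpow_neg_le_gallagerMean (hq : ∀ y, 0 ≤ q y) (hq1 : ∑ y, q y = 1)
    (hz : ∀ y, z y ∈ Set.Icc (0 : ℝ) 1) {r : ℝ} (hr : 0 ≤ r) :
    2 ^ (-r) ≤ gallagerMean q z r := by
  rw [← one_mul ((2 : ℝ) ^ (-r)), ← hq1, Finset.sum_mul]
  exact Finset.sum_le_sum fun y _ =>
    mul_le_mul_of_nonneg_left (two_rpow_neg_le_gallagerKernel hr (hz y)) (hq y)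

theorem gallagerMean_pos (hq : ∀ y, 0 ≤ q y) (hq1 : ∑ y, q y = 1)
    (hz : ∀ y, z y ∈ Set.Icc (0 : ℝ) 1) {r : ℝ} (hr : 0 ≤ r) : 0 < gallagerMean q z r :=
  (rpow_pos_of_pos two_pos _).trans_le (two_rpow_neg_le_gallagerMean hq hq1 hz hr)

theorem deriv_gallagerMean_nonpos (hq : ∀ y, 0 ≤ q y) (hz : ∀ y, z y ∈ Set.Icc (0 : ℝ) 1)
    {s : ℝ} (hs : 0 < s) : deriv (gallagerMean q z) s ≤ 0 := by
  have := deriv_le_deriv_of_le_left hs (differentiableAt_gallagerMean (q := q) hz hs)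
    (differentiableAt_const (gallagerMean q z s)) rfl
    fun r hr => gallagerMean_antitone hq hz hr.1.le hr.2.le
  rwa [deriv_const] at this

theorem gallagerMean_le_tangent (hq : ∀ y, 0 ≤ q y) (hq1 : ∑ y, q y = 1)
    (hz : ∀ y, z y ∈ Set.Icc (0 : ℝ) 1) {r s z₀ : ℝ} (hr : 0 < r) (hrs : r ≤ s) (hs : s ≤ 3)
    (hz₀ : z₀ ∈ Set.Ioo (0 : ℝ) 1) :
    gallagerMean q z s ≤ gallagerKernel s z₀ + gallagerSlope s z₀ / gallagerSlope r z₀ *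
      (gallagerMean q z r - gallagerKernel r z₀) := by
  have h := Finset.sum_le_sum fun y (_ : y ∈ Finset.univ) =>
    mul_le_mul_of_nonneg_left (gallagerKernel_le_tangent hr hrs hs hz₀ (hz y)) (hq y)
  refine h.trans_eq ?_
  have e : ∀ y, q y * (gallagerKernel s z₀ + gallagerSlope s z₀ / gallagerSlope r z₀ *
      (gallagerKernel r (z y) - gallagerKernel r z₀)) =
      q y * (gallagerKernel s z₀ - gallagerSlope s z₀ / gallagerSlope r z₀ *
        gallagerKernel r z₀) + gallagerSlope s z₀ / gallagerSlope r z₀ *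
        (q y * gallagerKernel r (z y)) := fun y => by ring
  simp only [e]
  rw [Finset.sum_add_distrib, ← Finset.sum_mul, ← Finset.mul_sum, hq1, gallagerMean]
  ring

theorem gallagerMean_chord_le (hq : ∀ y, 0 ≤ q y) (hq1 : ∑ y, q y = 1)
    (hz : ∀ y, z y ∈ Set.Icc (0 : ℝ) 1) {r s : ℝ} (hr : 0 < r) (hrs : r ≤ s) (hs : s ≤ 3) :
    (1 - 2 ^ (-s)) * (gallagerMean q z r - 2 ^ (-r)) ≤
      (1 - 2 ^ (-r)) * (gallagerMean q z s - 2 ^ (-s)) := by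
  have h := Finset.sum_le_sum fun y (_ : y ∈ Finset.univ) =>
    mul_le_mul_of_nonneg_left (gallagerKernel_chord_le hr hrs hs (hz y)) (hq y)
  have e : ∀ a b t : ℝ, a * (gallagerMean q z t - b) =
      ∑ y, q y * (a * (gallagerKernel t (z y) - b)) := fun a b t => by
    have e' : ∀ y, q y * (a * (gallagerKernel t (z y) - b)) =
      a * (q y * gallagerKernel t (z y)) - q y * (a * b) := fun y => by ring
    simp only [e']
    rw [Finset.sum_sub_distrib, ← Finset.sum_mul, ← Finset.mul_sum, hq1, gallagerMean]
    ring
  rwa [e, e]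

theorem gallagerMean_le_kernel_of_le (hq : ∀ y, 0 ≤ q y) (hq1 : ∑ y, q y = 1)
    (hz : ∀ y, z y ∈ Set.Icc (0 : ℝ) 1) {r s z₀ : ℝ} (hr : 0 < r) (hrs : r ≤ s) (hs : s ≤ 3)
    (hz₀ : z₀ ∈ Set.Icc (0 : ℝ) 1) (h : gallagerMean q z r ≤ gallagerKernel r z₀) :
    gallagerMean q z s ≤ gallagerKernel s z₀ := by
  have hs0 := hr.trans_le hrs
  have interior : ∀ w ∈ Set.Ioo (0 : ℝ) 1, gallagerMean q z r ≤ gallagerKernel r w →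
      gallagerMean q z s ≤ gallagerKernel s w := fun w hw h => by
    have h1 := gallagerMean_le_tangent hq hq1 hz hr hrs hs hw
    have h2 := mul_nonpos_of_nonneg_of_nonpos
      (div_pos (gallagerSlope_pos hs0 hw) (gallagerSlope_pos hr hw)).le (sub_nonpos.2 h)
    linarith
  rcases hz₀.1.eq_or_lt with rfl | h0
  · rw [gallagerKernel_zero_right]
    exact gallagerMean_le_one hq hq1 hz hs0.le
  rcases hz₀.2.eq_or_lt with rfl | h1
  · have hlim : Filter.Tendsto (gallagerKernel s) (nhdsWithin 1 (Set.Ioo 0 1))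
        (nhds (gallagerKernel s 1)) :=
      (continuousOn_gallagerKernel hs0.le 1 hz₀).mono Set.Ioo_subset_Icc_self
    have : (nhdsWithin (1 : ℝ) (Set.Ioo 0 1)).NeBot := right_nhdsWithin_Ioo_neBot one_pos
    refine ge_of_tendsto hlim ?_
    filter_upwards [self_mem_nhdsWithin] with w hw
    refine interior w hw (h.trans ?_)
    rw [gallagerKernel_one_right (by linarith)]
    exact two_rpow_neg_le_gallagerKernel hr.le (Set.Ioo_subset_Icc_self hw)
  · exact interior z₀ ⟨h0, h1⟩ h

theorem kernel_le_mixture_of_eq (hq : ∀ y, 0 ≤ q y) (hq1 : ∑ y, q y = 1)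
    (hz : ∀ y, z y ∈ Set.Icc (0 : ℝ) 1) {r s z₀ t : ℝ} (hr : 0 < r) (hrs : r ≤ s) (hs : s ≤ 3)
    (hz₀ : z₀ ∈ Set.Icc (0 : ℝ) 1) (ht : t ∈ Set.Icc (0 : ℝ) 1)
    (h : t * gallagerMean q z s + (1 - t) = gallagerKernel s z₀) :
    gallagerKernel r z₀ ≤ t * gallagerMean q z r + (1 - t) := by
  have hs0 := hr.trans_le hrs
  rcases hz₀.1.eq_or_lt with rfl | h0
  · rw [gallagerKernel_zero_right] at h ⊢
    rw [← h]
    have := mul_le_mul_of_nonneg_left (gallagerMean_antitone hq hz hr.le hrs) ht.1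
    linarith
  rcases hz₀.2.eq_or_lt with rfl | h1
  · rw [gallagerKernel_one_right (by linarith)]
    have h1 := two_rpow_neg_le_gallagerMean hq hq1 hz hr.le
    have h2 : (2 : ℝ) ^ (-r) ≤ 1 := rpow_le_one_of_one_le_of_nonpos one_le_two (by linarith)
    nlinarith [mul_le_mul_of_nonneg_left h1 ht.1,
      mul_le_mul_of_nonneg_left h2 (sub_nonneg.2 ht.2)]
  · have hw : z₀ ∈ Set.Ioo (0 : ℝ) 1 := ⟨h0, h1⟩
    have h2 := gallagerMean_le_tangent hq hq1 hz hr hrs hs hw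
    have h3 := gallagerKernel_le_tangent hr hrs hs hw (z := 0) ⟨le_rfl, zero_le_one⟩
    have hκ := div_pos (gallagerSlope_pos hs0 hw) (gallagerSlope_pos hr hw)
    rw [gallagerKernel_zero_right, gallagerKernel_zero_right] at h3
    have h4 := mul_le_mul_of_nonneg_left h2 ht.1
    have h5 := mul_le_mul_of_nonneg_left h3 (sub_nonneg.2 ht.2)
    have h6 : 0 ≤ gallagerSlope s z₀ / gallagerSlope r z₀ *
        (t * gallagerMean q z r + (1 - t) - gallagerKernel r z₀) := by linarith
    exact sub_nonneg.1 (nonneg_of_mul_nonneg_right h6 hκ)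

theorem kernel_rate_le_gallagerMean_rate (hq : ∀ y, 0 ≤ q y) (hq1 : ∑ y, q y = 1)
    (hz : ∀ y, z y ∈ Set.Icc (0 : ℝ) 1) {s z₀ : ℝ} (hs0 : 0 < s) (hs : s ≤ 3)
    (hz₀ : z₀ ∈ Set.Icc (0 : ℝ) 1) (h : gallagerMean q z s ≤ gallagerKernel s z₀) :
    -deriv (fun r => gallagerKernel r z₀) s / gallagerKernel s z₀ ≤
      -deriv (gallagerMean q z) s / gallagerMean q z s := by
  have hm := gallagerMean_pos hq hq1 hz hs0.le
  have hk := gallagerKernel_pos s hz₀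
  have hk1 := gallagerKernel_le_one hs0.le hz₀
  obtain ⟨t, ht, hteq⟩ : ∃ t ∈ Set.Icc (0 : ℝ) 1,
      t * gallagerMean q z s + (1 - t) = gallagerKernel s z₀ := by
    rcases (gallagerMean_le_one hq hq1 hz hs0.le).eq_or_lt with h1 | h1
    · exact ⟨1, ⟨zero_le_one, le_rfl⟩, by linarith⟩
    · have hpos := sub_pos.2 h1
      refine ⟨(1 - gallagerKernel s z₀) / (1 - gallagerMean q z s),
        ⟨div_nonneg (by linarith) hpos.le, (div_le_one hpos).2 (by linarith)⟩, ?_⟩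
      field_simp
      ring
  have hdiff := differentiableAt_gallagerMean (q := q) hz hs0
  have hderiv := deriv_le_deriv_of_le_left hs0 ((hdiff.const_mul t).add_const (1 - t))
    (differentiableAt_gallagerKernel_left hs0 hz₀) hteq
    fun r hr => kernel_le_mixture_of_eq hq hq1 hz hr.1 hr.2.le hs hz₀ ht hteq
  rw [deriv_add_const, deriv_const_mul _ hdiff] at hderiv
  have hneg := deriv_gallagerMean_nonpos hq hz hs0
  rw [div_le_div_iff₀ hk hm]
  have h1 := mul_le_mul_of_nonneg_right hderiv hm.le
  have h2 : t * gallagerMean q z s ≤ gallagerKernel s z₀ := by linarith [ht.2]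
  nlinarith [mul_le_mul_of_nonpos_left h2 hneg]

theorem erasure_le_gallagerMean_of_le (hq : ∀ y, 0 ≤ q y) (hq1 : ∑ y, q y = 1)
    (hz : ∀ y, z y ∈ Set.Icc (0 : ℝ) 1) {r s ε : ℝ} (hr : 0 < r) (hrs : r ≤ s) (hs : s ≤ 3)
    (h : 2 ^ (-r) * (1 - ε) + ε ≤ gallagerMean q z r) :
    2 ^ (-s) * (1 - ε) + ε ≤ gallagerMean q z s := by
  have hlt : ∀ t : ℝ, 0 < t → 0 < 1 - (2 : ℝ) ^ (-t) := fun t ht =>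
    sub_pos.2 (rpow_lt_one_of_one_lt_of_neg one_lt_two (neg_neg_of_pos ht))
  have h1 := gallagerMean_chord_le hq hq1 hz hr hrs hs
  have h2 := mul_le_mul_of_nonneg_left h (hlt s (hr.trans_le hrs)).le
  have h3 : 0 ≤ (1 - (2 : ℝ) ^ (-r)) * (gallagerMean q z s - (2 ^ (-s) * (1 - ε) + ε)) := by
    linarith
  exact sub_nonneg.1 (nonneg_of_mul_nonneg_right h3 (hlt r hr))

theorem hasDerivAt_erasure (s ε : ℝ) :
    HasDerivAt (fun r : ℝ => (2 : ℝ) ^ (-r) * (1 - ε) + ε)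
      (-(log 2 * 2 ^ (-s) * (1 - ε))) s := by
  refine ((((hasDerivAt_id s).neg.const_rpow two_pos).mul_const (1 - ε)).add_const
    ε).congr_deriv ?_
  simp only [Pi.neg_apply, id]
  ring

theorem gallagerMean_rate_le_erasure_rate (hq : ∀ y, 0 ≤ q y) (hq1 : ∑ y, q y = 1)
    (hz : ∀ y, z y ∈ Set.Icc (0 : ℝ) 1) {s ε : ℝ} (hs0 : 0 < s) (hs : s ≤ 3)
    (hε : 0 ≤ ε) (h : 2 ^ (-s) * (1 - ε) + ε ≤ gallagerMean q z s) :
    -deriv (gallagerMean q z) s / gallagerMean q z s ≤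
      -deriv (fun r : ℝ => (2 : ℝ) ^ (-r) * (1 - ε) + ε) s / (2 ^ (-s) * (1 - ε) + ε) := by
  have hlt : ∀ t : ℝ, 0 < t → 0 < 1 - (2 : ℝ) ^ (-t) := fun t ht =>
    sub_pos.2 (rpow_lt_one_of_one_lt_of_neg one_lt_two (neg_neg_of_pos ht))
  have hm := gallagerMean_pos hq hq1 hz hs0.le
  have hpow : (0 : ℝ) < 2 ^ (-s) := rpow_pos_of_pos two_pos _
  have hs1 := hlt s hs0
  have hb : 0 < 2 ^ (-s) * (1 - ε) + ε := by nlinarith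
  set δ := (gallagerMean q z s - 2 ^ (-s)) / (1 - 2 ^ (-s)) with hδ
  have hδeq : gallagerMean q z s = 2 ^ (-s) * (1 - δ) + δ := by
    rw [hδ]; field_simp; ring
  have hεδ : ε ≤ δ := by
    rw [hδ, le_div_iff₀ hs1]; linarith
  have hderiv := deriv_le_deriv_of_le_left hs0 (hasDerivAt_erasure s δ).differentiableAt
    (differentiableAt_gallagerMean (q := q) hz hs0) hδeq.symm fun r hr => by
      have h1 := gallagerMean_chord_le hq hq1 hz hr.1 hr.2.le hs
      have h2 : gallagerMean q z s - 2 ^ (-s) = δ * (1 - 2 ^ (-s)) := by rw [hδeq]; ring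
      rw [h2] at h1
      have h3 : 0 ≤ (1 - (2 : ℝ) ^ (-s)) * (2 ^ (-r) * (1 - δ) + δ - gallagerMean q z r) := by
        linarith
      exact sub_nonneg.1 (nonneg_of_mul_nonneg_right h3 hs1)
  rw [(hasDerivAt_erasure s δ).deriv] at hderiv
  rw [(hasDerivAt_erasure s ε).deriv, neg_neg]
  calc -deriv (gallagerMean q z) s / gallagerMean q z s
      ≤ log 2 * 2 ^ (-s) * (1 - δ) / gallagerMean q z s :=
        div_le_div_of_nonneg_right (by linarith) hm.le
    _ ≤ _ := by
        have hl : 0 < log 2 * 2 ^ (-s) := mul_pos (log_pos one_lt_two) hpow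
        rw [div_le_div_iff₀ hm hb, hδeq, mul_assoc _ (1 - δ), mul_assoc _ (1 - ε)]
        refine mul_le_mul_of_nonneg_left ?_ hl.le
        linarith

end Mean

theorem half_add_half_rpow_eq {a b r : ℝ} (ha : 0 ≤ a) (hb : 0 ≤ b) (hr : -1 < r) :
    (1 / 2 * a ^ (1 / (1 + r)) + 1 / 2 * b ^ (1 / (1 + r))) ^ (1 + r) =
      (a + b) / 2 * gallagerKernel r (|a - b| / (a + b)) := by
  wlog hab : b ≤ a generalizing a b
  · rw [add_comm (1 / 2 * a ^ _), this hb ha (le_of_not_ge hab), abs_sub_comm, add_comm b]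
  have hr1 : 1 + r ≠ 0 := by linarith
  rcases (add_nonneg ha hb).eq_or_lt with h0 | h0
  · obtain rfl : a = 0 := by linarith
    obtain rfl : b = 0 := by linarith
    simp [zero_rpow (inv_ne_zero hr1), zero_rpow hr1]
  rw [abs_of_nonneg (sub_nonneg.2 hab), gallagerKernel]
  have hq : 0 ≤ (a + b) / 2 := by linarith
  have e1 : 0 ≤ 1 + (a - b) / (a + b) := by
    have : 0 ≤ (a - b) / (a + b) := div_nonneg (sub_nonneg.2 hab) h0.le
    linarith
  have e2 : 0 ≤ 1 - (a - b) / (a + b) := by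
    rw [sub_nonneg, div_le_one h0]; linarith
  have ea : a = (a + b) / 2 * (1 + (a - b) / (a + b)) := by field_simp; ring
  have eb : b = (a + b) / 2 * (1 - (a - b) / (a + b)) := by field_simp; ring
  have hroot : (((a + b) / 2) ^ (1 / (1 + r))) ^ (1 + r) = (a + b) / 2 := by
    rw [← rpow_mul hq, one_div_mul_cancel hr1, rpow_one]
  have ha' : a ^ (1 / (1 + r)) =
      ((a + b) / 2) ^ (1 / (1 + r)) * (1 + (a - b) / (a + b)) ^ (1 / (1 + r)) := by
    rw [← mul_rpow hq e1, ← ea]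
  have hb' : b ^ (1 / (1 + r)) =
      ((a + b) / 2) ^ (1 / (1 + r)) * (1 - (a - b) / (a + b)) ^ (1 / (1 + r)) := by
    rw [← mul_rpow hq e2, ← eb]
  rw [ha', hb', mul_left_comm, mul_left_comm (1 / 2 : ℝ) (((a + b) / 2) ^ (1 / (1 + r))),
    ← mul_add, mul_rpow (rpow_nonneg hq _) (by positivity), hroot]

theorem abs_sub_div_add_mem_Icc {a b : ℝ} (ha : 0 ≤ a) (hb : 0 ≤ b) :
    |a - b| / (a + b) ∈ Set.Icc (0 : ℝ) 1 :=
  ⟨by positivity, div_le_one_of_le₀ (abs_le.2 ⟨by linarith, by linarith⟩) (add_nonneg ha hb)⟩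

namespace BDMC

variable (W : BDMC)

/-- The output distribution under uniform input. -/
noncomputable def outputProb (y : W.Y) : ℝ := (W.W0 y + W.W1 y) / 2

/-- `|1 - 2 x|`, where `x` is the posterior probability of input `0` given the output. -/
noncomputable def posteriorBias (y : W.Y) : ℝ := |W.W0 y - W.W1 y| / (W.W0 y + W.W1 y)

theorem outputProb_nonneg (y : W.Y) : 0 ≤ W.outputProb y :=
  div_nonneg (add_nonneg (W.W0_nonneg y) (W.W1_nonneg y)) zero_le_two

theorem sum_outputProb : ∑ y, W.outputProb y = 1 := by
  simp only [outputProb]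
  rw [← Finset.sum_div, Finset.sum_add_distrib, W.sum_W0, W.sum_W1]
  norm_num

theorem posteriorBias_mem_Icc (y : W.Y) : W.posteriorBias y ∈ Set.Icc (0 : ℝ) 1 :=
  abs_sub_div_add_mem_Icc (W.W0_nonneg y) (W.W1_nonneg y)

end BDMC

theorem E0_eq_neg_log_gallagerMean (W : BDMC) {r : ℝ} (hr : -1 < r) :
    E0 r W = -log (gallagerMean W.outputProb W.posteriorBias r) := by
  rw [E0, gallagerMean]
  congr 2
  exact Finset.sum_congr rfl fun y _ =>
    half_add_half_rpow_eq (W.W0_nonneg y) (W.W1_nonneg y) hr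

theorem E0bsc_eq_neg_log_gallagerKernel {x r : ℝ} (hx : x ∈ Set.Icc (0 : ℝ) (1 / 2))
    (hr : -1 < r) : E0bsc r x = -log (gallagerKernel r (1 - 2 * x)) := by
  have hx1 : 0 ≤ 1 - x := by linarith [hx.2]
  have h := half_add_half_rpow_eq hx1 hx.1 hr
  rw [show 1 - x + x = 1 by ring, div_one, show 1 - x - x = 1 - 2 * x by ring,
    abs_of_nonneg (by linarith [hx.2])] at h
  have hsum : 0 ≤ x ^ (1 / (1 + r)) + (1 - x) ^ (1 / (1 + r)) :=
    add_nonneg (rpow_nonneg hx.1 _) (rpow_nonneg hx1 _)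
  rw [← mul_add, mul_rpow (by norm_num) (by linarith), add_comm (_ ^ _)] at h
  have h2 : ((1 : ℝ) / 2) ^ (1 + r) = 1 / 2 * 2 ^ (-r) := by
    rw [one_div, inv_rpow zero_le_two, ← rpow_neg zero_le_two, neg_add,
      rpow_add two_pos, rpow_neg_one]
  rw [h2] at h
  rw [E0bsc]
  congr 2
  linarith

theorem deriv_neg_log_eq {e f : ℝ → ℝ} {s : ℝ} (hs : 0 < s) (he : ∀ r, 0 < r → e r = -log (f r))
    (hf : DifferentiableAt ℝ f s) (hpos : 0 < f s) : deriv e s = -deriv f s / f s := by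
  have h : e =ᶠ[nhds s] fun r => -log (f r) := by
    filter_upwards [lt_mem_nhds hs] with r hr using he r hr
  rw [h.deriv_eq, (hf.hasDerivAt.log hpos.ne').fun_neg.deriv, neg_div]

/-- Theorem 1, Part 1: if `ρ₁ ∈ (0,3]` and
`E₀(ρ₁, BSC_x) ≤ E₀(ρ₁, W) ≤ E₀(ρ₁, BEC_ε)`, then for every `ρ₂ ∈ [ρ₁, 3]` both
the rates and the `E₀` values are ordered in the same way. -/
theorem extremality_part1 (W : BDMC) (ε x ρ₁ : ℝ)
    (hε : ε ∈ Set.Icc (0:ℝ) 1) (hx : x ∈ Set.Icc (0:ℝ) (1/2))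
    (hρ₁ : ρ₁ ∈ Set.Ioc (0:ℝ) 3)
    (hBSC : E0bsc ρ₁ x ≤ E0 ρ₁ W) (hBEC : E0 ρ₁ W ≤ E0bec ρ₁ ε) :
    ∀ ρ₂ ∈ Set.Icc ρ₁ 3,
      (Rbsc ρ₂ x ≤ RW ρ₂ W ∧ RW ρ₂ W ≤ Rbec ρ₂ ε) ∧
      (E0bsc ρ₂ x ≤ E0 ρ₂ W ∧ E0 ρ₂ W ≤ E0bec ρ₂ ε) := by
  intro s ⟨hrs, hs⟩
  have hr := hρ₁.1
  have hs0 := hr.trans_le hrs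
  have hq := W.outputProb_nonneg
  have hq1 := W.sum_outputProb
  have hz := W.posteriorBias_mem_Icc
  have hz₀ : 1 - 2 * x ∈ Set.Icc (0 : ℝ) 1 := ⟨by linarith [hx.2], by linarith [hx.1]⟩
  have hW := fun r (hr : 0 < r) => E0_eq_neg_log_gallagerMean W (show -1 < r by linarith)
  have hB := fun r (hr : 0 < r) => E0bsc_eq_neg_log_gallagerKernel hx (show -1 < r by linarith)
  have hm := fun r (hr : 0 < r) => gallagerMean_pos hq hq1 hz (r := r) hr.le
  have hk := fun r => gallagerKernel_pos r hz₀
  have hb : ∀ r : ℝ, 0 < r → 0 < (2 : ℝ) ^ (-r) * (1 - ε) + ε := fun r hr => by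
    have h1 : (0 : ℝ) < 2 ^ (-r) := rpow_pos_of_pos two_pos _
    have h2 : (2 : ℝ) ^ (-r) < 1 := rpow_lt_one_of_one_lt_of_neg one_lt_two (neg_neg_of_pos hr)
    nlinarith [mul_nonneg hε.1 (sub_pos.2 h2).le]
  rw [hW _ hr, hB _ hr, neg_le_neg_iff, log_le_log_iff (hm _ hr) (hk _)] at hBSC
  rw [hW _ hr, E0bec, neg_le_neg_iff, log_le_log_iff (hb _ hr) (hm _ hr)] at hBEC
  have hBSC' := gallagerMean_le_kernel_of_le hq hq1 hz hr hrs hs hz₀ hBSC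
  have hBEC' := erasure_le_gallagerMean_of_le hq hq1 hz hr hrs hs hBEC
  have hRW : RW s W = _ := deriv_neg_log_eq hs0 hW (differentiableAt_gallagerMean hz hs0) (hm s hs0)
  have hRbsc : Rbsc s x = _ :=
    deriv_neg_log_eq hs0 hB (differentiableAt_gallagerKernel_left hs0 hz₀) (hk s)
  have hRbec : Rbec s ε = _ :=
    deriv_neg_log_eq hs0 (fun r _ => rfl) (hasDerivAt_erasure s ε).differentiableAt (hb s hs0)
  refine ⟨⟨?_, ?_⟩, ?_, ?_⟩
  · rw [hRW, hRbsc]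
    exact kernel_rate_le_gallagerMean_rate hq hq1 hz hs0 hs hz₀ hBSC'
  · rw [hRW, hRbec]
    exact gallagerMean_rate_le_erasure_rate hq hq1 hz hs0 hs hε.1 hBEC'
  · rw [hW _ hs0, hB _ hs0, neg_le_neg_iff, log_le_log_iff (hm _ hs0) (hk _)]
    exact hBSC'
  · rw [hW _ hs0, E0bec, neg_le_neg_iff, log_le_log_iff (hb _ hs0) (hm _ hs0)]
    exact hBEC'
end
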